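/- Let σ > 1 and let 1 ≤ p < σ. Then the σ-Brjuno function B_σ (defined Lebesgue-almost everywhere on (0,1), since the irrationals have full measure) belongs to L^p(0,1): the function x ↦ B_σ(x) is measurable and ∫_0^1 B_σ(x)^p dx < +∞. In particular B_2 ∈ L^1(0,1). -/

import Mathlib

open Real Set MeasureTheory
open scoped ENNReal

/-- The Gauss map `A(x) = 1/x - ⌊1/x⌋`. -/
noncomputable def gaussMap (x : ℝ) : ℝ := 1 / x - (⌊1 / x⌋ : ℝ)

/-- `brjunoBeta x j = β_{j-1}(x) = ∏_{i=0}^{j-1} A^i(x)`; in particular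
`brjunoBeta x 0 = β_{-1}(x) = 1` and `β_K(x) = brjunoBeta x (K+1)`. -/
noncomputable def brjunoBeta (x : ℝ) (j : ℕ) : ℝ := ∏ i ∈ Finset.range j, gaussMap^[i] x

/-- The σ-Brjuno function `B_σ(x) = Σ_{j≥0} β_{j-1}(x) · (A^j x)^{-1/σ}`, valued in `[0,+∞]`. -/
noncomputable def brjuno (σ x : ℝ) : ℝ≥0∞ :=
  ∑' j : ℕ, ENNReal.ofReal (brjunoBeta x j * (gaussMap^[j] x) ^ (-(1 / σ)))

/-- The K-th partial sum `B_σ^{(K)}(x) = Σ_{j=0}^{K} β_{j-1}(x) · (A^j x)^{-1/σ}`. -/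
noncomputable def brjunoPartial (σ x : ℝ) (K : ℕ) : ℝ :=
  ∑ j ∈ Finset.range (K + 1), brjunoBeta x j * (gaussMap^[j] x) ^ (-(1 / σ))

/-- The fixed point `η_m = (√(m²+4) − m)/2 = [0; m, m, m, ...]` of the Gauss map. -/
noncomputable def eta (m : ℕ) : ℝ := (Real.sqrt ((m : ℝ) ^ 2 + 4) - m) / 2

/-- `b* = (σ+1)^{1+1/σ}/σ`. -/
noncomputable def bstar (σ : ℝ) : ℝ := (σ + 1) ^ (1 + 1 / σ) / σ

/-- The global lower bound `g(x) = x^{-1/σ} + b*·x`. -/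
noncomputable def gLow (σ x : ℝ) : ℝ := x ^ (-(1 / σ)) + bstar σ * x

/-- The cylinder lower bound `g_k(x) = x^{-1/σ} + x·(1/x − k)^{-1/σ} + (1 − kx)·b*`. -/
noncomputable def gCyl (σ : ℝ) (k : ℕ) (x : ℝ) : ℝ :=
  x ^ (-(1 / σ)) + x * (1 / x - (k : ℝ)) ^ (-(1 / σ)) + (1 - (k : ℝ) * x) * bstar σ

lemma measurable_gaussMap : Measurable gaussMap := by
  unfold gaussMap
  have h : Measurable fun x : ℝ => 1 / x := by fun_prop
  exact h.sub (measurable_from_top.comp h.floor)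

lemma gaussMap_eq_fract (x : ℝ) : gaussMap x = Int.fract (1 / x) := rfl

lemma measurable_brjunoBeta (j : ℕ) : Measurable fun x => brjunoBeta x j :=
  Finset.measurable_fun_prod _ fun i _ => measurable_gaussMap.iterate i

lemma measurable_brjuno_term (σ : ℝ) (j : ℕ) : Measurable fun x =>
    ENNReal.ofReal (brjunoBeta x j * (gaussMap^[j] x) ^ (-(1 / σ))) :=
  ((measurable_brjunoBeta j).mul
    ((measurable_gaussMap.iterate j).pow_const _)).ennreal_ofReal

lemma measurable_brjuno (σ : ℝ) : Measurable (brjuno σ) :=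
  Measurable.tsum fun j => measurable_brjuno_term σ j

lemma brjunoBeta_succ (x : ℝ) (j : ℕ) :
    brjunoBeta x (j + 1) = x * brjunoBeta (gaussMap x) j := by
  simp [brjunoBeta, Finset.prod_range_succ', mul_comm]

lemma iterate_gaussMap_mem_Ico {x : ℝ} (hx : x ∈ Ico (0 : ℝ) 1) (i : ℕ) :
    gaussMap^[i] x ∈ Ico (0 : ℝ) 1 := by
  cases i with
  | zero => exact hx
  | succ i =>
    rw [Function.iterate_succ_apply', gaussMap_eq_fract]
    exact ⟨Int.fract_nonneg _, Int.fract_lt_one _⟩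

lemma brjunoBeta_nonneg {x : ℝ} (hx : x ∈ Ico (0 : ℝ) 1) (j : ℕ) : 0 ≤ brjunoBeta x j :=
  Finset.prod_nonneg fun i _ => (iterate_gaussMap_mem_Ico hx i).1

lemma brjunoBeta_le_one {x : ℝ} (hx : x ∈ Ico (0 : ℝ) 1) (j : ℕ) : brjunoBeta x j ≤ 1 :=
  Finset.prod_le_one (fun i _ => (iterate_gaussMap_mem_Ico hx i).1)
    fun i _ => (iterate_gaussMap_mem_Ico hx i).2.le

/-- The maps `y ↦ 1 / (k + 1 + y)` are inverse branches of the Gauss map. -/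
lemma gaussMap_inv_branch (k : ℕ) {y : ℝ} (hy : y ∈ Ico (0 : ℝ) 1) :
    gaussMap (1 / ((k : ℝ) + 1 + y)) = y := by
  rw [gaussMap_eq_fract, one_div_one_div]
  have : (k : ℝ) + 1 + y = ((k + 1 : ℕ) : ℝ) + y := by push_cast; ring
  rw [this, Int.fract_natCast_add, Int.fract_eq_self.2 ⟨hy.1, hy.2⟩]

lemma Ioo_subset_iUnion_inv_branch :
    Ioo (0 : ℝ) 1 ⊆ ⋃ k : ℕ, (fun y : ℝ => 1 / ((k : ℝ) + 1 + y)) '' Ico (0 : ℝ) 1 := by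
  intro x hx
  have h1 : 1 < 1 / x := by rw [lt_div_iff₀ hx.1]; linarith [hx.2]
  have hf : 1 ≤ ⌊1 / x⌋₊ := Nat.one_le_floor_iff _ |>.2 h1.le
  refine mem_iUnion.2 ⟨⌊1 / x⌋₊ - 1, 1 / x - ⌊1 / x⌋₊, ⟨?_, ?_⟩, ?_⟩
  · exact sub_nonneg.2 (Nat.floor_le (by linarith))
  · linarith [Nat.lt_floor_add_one (1 / x)]
  · push_cast [hf]
    rw [show ((⌊1 / x⌋₊ : ℝ) - 1 + 1 + (1 / x - ⌊1 / x⌋₊)) = 1 / x by ring, one_div_one_div]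

lemma setLIntegral_le_tsum_inv_branch (F : ℝ → ℝ≥0∞) :
    ∫⁻ x in Ico (0 : ℝ) 1, F x ≤
      ∑' k : ℕ, ∫⁻ y in Ico (0 : ℝ) 1,
        ENNReal.ofReal (1 / ((k : ℝ) + 1 + y) ^ 2) * F (1 / ((k : ℝ) + 1 + y)) := by
  rw [← setLIntegral_congr Ioo_ae_eq_Ico]
  refine (lintegral_mono_set Ioo_subset_iUnion_inv_branch).trans
    ((lintegral_iUnion_le _ _).trans (ENNReal.tsum_le_tsum fun k => ?_))
  have hpos : ∀ y ∈ Ico (0 : ℝ) 1, 0 < (k : ℝ) + 1 + y := fun y hy => by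
    have := hy.1; positivity
  rw [lintegral_image_eq_lintegral_abs_deriv_mul measurableSet_Ico
    (f' := fun y => -1 / ((k : ℝ) + 1 + y) ^ 2)]
  · refine (setLIntegral_congr_fun measurableSet_Ico fun y hy => ?_).le
    simp only [abs_div, abs_neg, abs_one, abs_pow, abs_of_pos (hpos y hy)]
  · intro y hy
    have h := ((hasDerivAt_id y).const_add ((k : ℝ) + 1)).inv (hpos y hy).ne'
    simp only [one_div]
    exact h.hasDerivWithinAt
  · intro a ha b hb hab
    have := congrArg (fun t => 1 / t) hab
    simp only [one_div_one_div] at this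
    linarith

lemma sum_weight_inv_branch_le {y : ℝ} (hy : 0 ≤ y) (n : ℕ) :
    ∑ k ∈ Finset.range n, 1 / (((k : ℝ) + 1 + y) ^ 2 * ((k : ℝ) + 2 + y)) ≤
      3 / 4 * (1 / (1 + y)) := by
  have key : ∀ n : ℕ,
      ∑ k ∈ Finset.range (n + 1), 1 / (((k : ℝ) + 1 + y) ^ 2 * ((k : ℝ) + 2 + y)) ≤
        1 / ((1 + y) ^ 2 * (2 + y)) + 1 / (2 + y) * (1 / (2 + y) - 1 / (n + 2 + y)) := by
    intro n
    induction n with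
    | zero => simp
    | succ n ih =>
      rw [Finset.sum_range_succ]
      have h : 1 / ((((n + 1 : ℕ) : ℝ) + 1 + y) ^ 2 * (((n + 1 : ℕ) : ℝ) + 2 + y)) ≤
          1 / (2 + y) * (1 / (n + 2 + y) - 1 / (((n + 1 : ℕ) : ℝ) + 2 + y)) := by
        push_cast
        rw [show 1 / (2 + y) * (1 / ((n : ℝ) + 2 + y) - 1 / ((n : ℝ) + 1 + 2 + y)) =
          1 / ((2 + y) * ((n : ℝ) + 2 + y) * ((n : ℝ) + 1 + 2 + y)) by field_simp; ring]
        rw [show (n : ℝ) + 1 + 1 + y = n + 2 + y by ring, sq]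
        gcongr
        have : (0 : ℝ) ≤ n := n.cast_nonneg
        linarith
      linarith
  have hle : ∑ k ∈ Finset.range n, 1 / (((k : ℝ) + 1 + y) ^ 2 * ((k : ℝ) + 2 + y)) ≤
      ∑ k ∈ Finset.range (n + 1), 1 / (((k : ℝ) + 1 + y) ^ 2 * ((k : ℝ) + 2 + y)) := by
    rw [Finset.sum_range_succ]
    have : 0 ≤ 1 / (((n : ℝ) + 1 + y) ^ 2 * ((n : ℝ) + 2 + y)) := by positivity
    linarith
  refine hle.trans ((key n).trans ?_)
  calc _ ≤ 1 / ((1 + y) ^ 2 * (2 + y)) + 1 / (2 + y) * (1 / (2 + y)) := by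
        gcongr
        have : 0 ≤ 1 / ((n : ℝ) + 2 + y) := by positivity
        linarith
    _ ≤ 3 / 4 * (1 / (1 + y)) := by
        rw [div_mul_div_comm, div_mul_div_comm, div_add_div _ _ (by positivity) (by positivity),
          div_le_div_iff₀ (by positivity) (by positivity), ← sub_nonneg]
        ring_nf
        positivity

/-- Contraction property of the weighted transfer operator of the Gauss map, for the weight
`1 / (1 + x)` of the invariant measure. -/
lemma lintegral_mul_comp_gaussMap_le {h : ℝ → ℝ≥0∞} (hh : Measurable h) :
    ∫⁻ x in Ico (0 : ℝ) 1,
        ENNReal.ofReal (1 / (1 + x)) * (ENNReal.ofReal x * h (gaussMap x)) ≤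
      ENNReal.ofReal (3 / 4) * ∫⁻ x in Ico (0 : ℝ) 1, ENNReal.ofReal (1 / (1 + x)) * h x := by
  calc _ ≤ _ := setLIntegral_le_tsum_inv_branch _
    _ = ∑' k : ℕ, ∫⁻ y in Ico (0 : ℝ) 1,
          ENNReal.ofReal (1 / (((k : ℝ) + 1 + y) ^ 2 * ((k : ℝ) + 2 + y))) * h y := by
        refine tsum_congr fun k => setLIntegral_congr_fun measurableSet_Ico fun y hy => ?_
        have hy0 := hy.1
        simp only [gaussMap_inv_branch k hy]
        rw [← mul_assoc, ← mul_assoc, ← ENNReal.ofReal_mul (by positivity),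
          ← ENNReal.ofReal_mul (by positivity)]
        congr 2
        field_simp
        ring
    _ = ∫⁻ y in Ico (0 : ℝ) 1, ∑' k : ℕ,
          ENNReal.ofReal (1 / (((k : ℝ) + 1 + y) ^ 2 * ((k : ℝ) + 2 + y))) * h y := by
        refine (lintegral_tsum fun k => ?_).symm
        exact (Measurable.mul (by fun_prop) hh).aemeasurable
    _ ≤ ∫⁻ y in Ico (0 : ℝ) 1,
          ENNReal.ofReal (3 / 4) * (ENNReal.ofReal (1 / (1 + y)) * h y) := by
        refine setLIntegral_mono' measurableSet_Ico fun y hy => ?_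
        have hy0 := hy.1
        rw [ENNReal.tsum_mul_right, ← mul_assoc, ← ENNReal.ofReal_mul (by norm_num)]
        gcongr
        refine ENNReal.tsum_le_of_sum_range_le fun n => ?_
        rw [← ENNReal.ofReal_sum_of_nonneg fun k _ => by positivity]
        exact ENNReal.ofReal_le_ofReal (sum_weight_inv_branch_le hy0 n)
    _ = _ := lintegral_const_mul' _ _ ENNReal.ofReal_ne_top

lemma lintegral_brjunoBeta_mul_comp_iterate_le {h : ℝ → ℝ≥0∞} (hh : Measurable h) (j : ℕ) :
    ∫⁻ x in Ico (0 : ℝ) 1, ENNReal.ofReal (1 / (1 + x)) *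
        (ENNReal.ofReal (brjunoBeta x j) * h (gaussMap^[j] x)) ≤
      ENNReal.ofReal (3 / 4) ^ j *
        ∫⁻ x in Ico (0 : ℝ) 1, ENNReal.ofReal (1 / (1 + x)) * h x := by
  induction j with
  | zero => simp [brjunoBeta]
  | succ j ih =>
    rw [pow_succ', mul_assoc]
    refine le_trans ?_ (mul_le_mul_right ih _)
    refine le_trans (le_of_eq ?_) (lintegral_mul_comp_gaussMap_le
      (h := fun x => ENNReal.ofReal (brjunoBeta x j) * h (gaussMap^[j] x))
      ((measurable_brjunoBeta j).ennreal_ofReal.mul (hh.comp (measurable_gaussMap.iterate j))))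
    refine setLIntegral_congr_fun measurableSet_Ico fun x hx => ?_
    simp only [brjunoBeta_succ, ENNReal.ofReal_mul hx.1, Function.iterate_succ_apply, mul_assoc]

lemma lintegral_rpow_neg_lt_top {s : ℝ} (hs : s < 1) :
    ∫⁻ x in Ico (0 : ℝ) 1, ENNReal.ofReal (x ^ (-s)) < ⊤ := by
  rw [← setLIntegral_congr Ioo_ae_eq_Ico]
  have h : IntegrableOn (fun x : ℝ => x ^ (-s)) (Ioo 0 1) :=
    (intervalIntegral.integrableOn_Ioo_rpow_iff zero_lt_one).2 (by linarith)
  exact h.lintegral_lt_top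

lemma exists_lintegral_brjuno_term_rpow_le {σ p : ℝ} (hσ : 1 < σ) (hp : 1 ≤ p) (hpσ : p < σ) :
    ∃ C : ℝ≥0∞, C ≠ ⊤ ∧ ∀ j : ℕ,
      ∫⁻ x in Ico (0 : ℝ) 1,
        ENNReal.ofReal (brjunoBeta x j * (gaussMap^[j] x) ^ (-(1 / σ))) ^ p ≤
        ENNReal.ofReal (3 / 4) ^ j * C := by
  have hp0 : 0 ≤ p := by linarith
  have hpσ1 : p / σ < 1 := (div_lt_one (by linarith)).2 hpσ
  refine ⟨2 * ∫⁻ x in Ico (0 : ℝ) 1,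
      ENNReal.ofReal (1 / (1 + x)) * ENNReal.ofReal (x ^ (-(p / σ))), ?_, fun j => ?_⟩
  · refine ENNReal.mul_ne_top (by simp) (ne_top_of_le_ne_top
      (lintegral_rpow_neg_lt_top hpσ1).ne
      (setLIntegral_mono' measurableSet_Ico fun x hx => ?_))
    have hx0 := hx.1
    refine mul_le_of_le_one_left' (ENNReal.ofReal_le_one.2 ?_)
    rw [div_le_one (by positivity)]
    linarith
  · rw [mul_left_comm]
    refine le_trans ?_ (mul_le_mul_right (lintegral_brjunoBeta_mul_comp_iterate_le
      (h := fun x => ENNReal.ofReal (x ^ (-(p / σ)))) (by fun_prop) j) 2)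
    rw [← lintegral_const_mul' _ _ (by simp)]
    refine setLIntegral_mono' measurableSet_Ico fun x hx => ?_
    have hx0 := hx.1
    have hb := brjunoBeta_nonneg hx j
    have hy := (iterate_gaussMap_mem_Ico hx j).1
    rw [← ENNReal.ofReal_ofNat 2, ← ENNReal.ofReal_mul hb, ← ENNReal.ofReal_mul (by positivity),
      ← ENNReal.ofReal_mul (by positivity), ENNReal.ofReal_rpow_of_nonneg (by positivity) hp0]
    refine ENNReal.ofReal_le_ofReal ?_
    rw [Real.mul_rpow hb (by positivity), ← Real.rpow_mul hy,
      show -(1 / σ) * p = -(p / σ) by ring]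
    have h1 : brjunoBeta x j ^ p ≤ brjunoBeta x j := by
      simpa using Real.rpow_le_rpow_of_exponent_ge' hb (brjunoBeta_le_one hx j) zero_le_one hp
    have h2 : 1 ≤ 2 * (1 / (1 + x)) := by
      rw [mul_one_div, le_div_iff₀ (by positivity)]
      linarith [hx.2]
    rw [← mul_assoc]
    calc _ ≤ brjunoBeta x j * (gaussMap^[j] x) ^ (-(p / σ)) := by gcongr
      _ ≤ _ := le_mul_of_one_le_left (by positivity) h2

/-- **Minkowski's inequality** for countable sums of `ℝ≥0∞`-valued functions. -/
lemma lintegral_Lp_tsum_le {α : Type*} [MeasurableSpace α] {μ : Measure α} {p : ℝ} (hp : 1 ≤ p)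
    {f : ℕ → α → ℝ≥0∞} (hf : ∀ n, Measurable (f n)) :
    (∫⁻ a, (∑' n, f n a) ^ p ∂μ) ^ (1 / p) ≤ ∑' n, (∫⁻ a, f n a ^ p ∂μ) ^ (1 / p) := by
  have hp0 : 0 < p := by linarith
  have hsum : ∀ n, (∫⁻ a, (∑ i ∈ Finset.range n, f i a) ^ p ∂μ) ^ (1 / p) ≤
      ∑ i ∈ Finset.range n, (∫⁻ a, f i a ^ p ∂μ) ^ (1 / p) := by
    intro n
    induction n with
    | zero => simp [hp0]
    | succ n ih =>
      simp only [Finset.sum_range_succ]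
      have hm : Measurable fun a => ∑ i ∈ Finset.range n, f i a :=
        Finset.measurable_fun_sum _ fun i _ => hf i
      exact (ENNReal.lintegral_Lp_add_le hm.aemeasurable (hf n).aemeasurable hp).trans
        (by gcongr)
  rw [one_div, ENNReal.rpow_inv_le_iff hp0, ← one_div]
  have hlim : ∀ a, (∑' n, f n a) ^ p = ⨆ n, (∑ i ∈ Finset.range n, f i a) ^ p := fun a => by
    rw [ENNReal.tsum_eq_iSup_nat]
    exact (ENNReal.orderIsoRpow p hp0).map_iSup _
  simp only [hlim]
  rw [lintegral_iSup]
  · refine iSup_le fun n => ?_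
    rw [← ENNReal.rpow_inv_le_iff hp0, ← one_div]
    exact (hsum n).trans (ENNReal.sum_le_tsum _)
  · exact fun n => (Finset.measurable_fun_sum _ fun i _ => hf i).pow_const p
  · intro m n hmn a
    exact ENNReal.rpow_le_rpow
      (Finset.sum_le_sum_of_subset (Finset.range_subset_range.2 hmn)) hp0.le

/-- for `σ > 1` and `1 ≤ p < σ`, `B_σ ∈ L^p(0,1)`: `B_σ` is measurable
and `∫_0^1 B_σ(x)^p dx < ∞`. -/
theorem brjuno_memLp (σ p : ℝ) (hσ : 1 < σ) (hp : 1 ≤ p) (hpσ : p < σ) :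
    Measurable (brjuno σ) ∧
      ∫⁻ x in Set.Ioo (0 : ℝ) 1, brjuno σ x ^ p < ⊤ := by
  refine ⟨measurable_brjuno σ, ?_⟩
  have hp0 : 0 < p := by linarith
  obtain ⟨C, hC, hbound⟩ := exists_lintegral_brjuno_term_rpow_le hσ hp hpσ
  rw [setLIntegral_congr Ioo_ae_eq_Ico, ← ENNReal.rpow_lt_top_iff_of_pos (one_div_pos.2 hp0)]
  calc _ ≤ _ := lintegral_Lp_tsum_le hp fun j => measurable_brjuno_term σ j
    _ ≤ ∑' j : ℕ, (ENNReal.ofReal (3 / 4) ^ (1 / p)) ^ j * C ^ (1 / p) := by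
        refine ENNReal.tsum_le_tsum fun j => ?_
        refine (ENNReal.rpow_le_rpow (hbound j) (by positivity)).trans_eq ?_
        rw [ENNReal.mul_rpow_of_nonneg _ _ (by positivity), ← ENNReal.rpow_natCast,
          ← ENNReal.rpow_natCast, ← ENNReal.rpow_mul, ← ENNReal.rpow_mul, mul_comm (j : ℝ)]
    _ < ⊤ := by
        rw [ENNReal.tsum_mul_right]
        refine ENNReal.mul_lt_top ?_ (ENNReal.rpow_lt_top_of_nonneg (by positivity) hC)
        rw [ENNReal.tsum_geometric, ENNReal.inv_lt_top, tsub_pos_iff_lt]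
        refine ENNReal.rpow_lt_one ?_ (by positivity)
        rw [ENNReal.ofReal_lt_one]
        norm_num
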